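/- arXiv:2503.10834 — 7 statements merged into one kernel-verified Lean document; each statement's English description precedes it below -/
import Mathlib

section
/- Let V be a finite type and r : V → V → Prop a relation (the edge relation of a directed graph) whose transitive closure Relation.TransGen r is irreflexive (i.e., the graph is acyclic). Let ℐ be a family of subsets of V (the intervention targets), and for each S ∈ ℐ let nd(S) := {v : V | ∀ s ∈ S, ¬ Relation.ReflTransGen r s v} be its non-descendant set. Define an equivalence relation on V by u ≈ v iff for every S ∈ ℐ, (u ∈ nd(S) ↔ v ∈ nd(S)) (this is the partition generated by the σ-algebra generated by the family of non-descendant sets). Then the quotient graph — whose vertices are the ≈-equivalence classes, with an edge from class A to class B iff A ≠ B and there exist a ∈ A, b ∈ B with r a b — is acyclic: the transitive closure of the quotient edge relation is irreflexive. -/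
/-- The non-descendant set of `S` in the directed graph with edge relation `r`:
vertices not reachable (by a possibly-empty directed path) from any node of `S`. -/
def nonDesc {V : Type*} (r : V → V → Prop) (S : Set V) : Set V :=
  {v | ∀ s ∈ S, ¬ Relation.ReflTransGen r s v}

/-- The equivalence relation "agreeing on membership in every non-descendant set of a
target in `ℐ`", i.e. the partition generated by the σ-algebra generated by the family
of non-descendant sets. -/
def ndSetoid {V : Type*} (r : V → V → Prop) (ℐ : Set (Set V)) : Setoid V :=
  ⟨fun u v => ∀ S ∈ ℐ, (u ∈ nonDesc r S ↔ v ∈ nonDesc r S),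
   ⟨fun _ _ _ => Iff.rfl,
    fun h S hS => (h S hS).symm,
    fun h1 h2 S hS => (h1 S hS).trans (h2 S hS)⟩⟩

/-- The edge relation of the quotient graph with respect to an equivalence relation on the
vertices: there is an edge from class `A` to class `B` iff `A ≠ B` and there is an edge
from some `a ∈ A` to some `b ∈ B` in the original graph. -/
def quotRel {V : Type*} (r : V → V → Prop) (s : Setoid V) :
    Quotient s → Quotient s → Prop :=
  fun A B => A ≠ B ∧ ∃ a b : V, Quotient.mk s a = A ∧ Quotient.mk s b = B ∧ r a b

/-- For a finite acyclic directed graph and any family `ℐ` of intervention targets, the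
quotient graph with respect to the partition generated by the σ-algebra generated by the
family of non-descendant sets of members of `ℐ` is acyclic. -/
theorem quotient_graph_of_nonDesc_partition_acyclic
    {V : Type*} [Finite V] (r : V → V → Prop)
    (hacyc : Irreflexive (Relation.TransGen r)) (ℐ : Set (Set V)) :
    Irreflexive (Relation.TransGen (quotRel r (ndSetoid r ℐ))) := by
  have step : ∀ A B, quotRel r (ndSetoid r ℐ) A B → ∀ a b : V,
      Quotient.mk (ndSetoid r ℐ) a = A → Quotient.mk (ndSetoid r ℐ) b = B →
      (∀ S ∈ ℐ, b ∈ nonDesc r S → a ∈ nonDesc r S) ∧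
      ¬ (∀ S ∈ ℐ, a ∈ nonDesc r S → b ∈ nonDesc r S) := by
    rintro A B ⟨hne, a', b', ha', hb', hr⟩ a b ha hb
    have h1 : ∀ S ∈ ℐ, (a ∈ nonDesc r S ↔ a' ∈ nonDesc r S) :=
      Quotient.exact (s := ndSetoid r ℐ) (ha.trans ha'.symm)
    have h2 : ∀ S ∈ ℐ, (b ∈ nonDesc r S ↔ b' ∈ nonDesc r S) :=
      Quotient.exact (s := ndSetoid r ℐ) (hb.trans hb'.symm)
    have h3 : ∀ S ∈ ℐ, b ∈ nonDesc r S → a ∈ nonDesc r S := fun S hS h =>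
      (h1 S hS).2 fun s hs hp => (h2 S hS).1 h s hs (hp.tail hr)
    refine ⟨h3, fun h4 => hne ?_⟩
    rw [← ha, ← hb]
    exact Quotient.sound (s := ndSetoid r ℐ) fun S hS => ⟨h4 S hS, h3 S hS⟩
  have key : ∀ A B, Relation.TransGen (quotRel r (ndSetoid r ℐ)) A B → ∀ a b : V,
      Quotient.mk (ndSetoid r ℐ) a = A → Quotient.mk (ndSetoid r ℐ) b = B →
      (∀ S ∈ ℐ, b ∈ nonDesc r S → a ∈ nonDesc r S) ∧
      ¬ (∀ S ∈ ℐ, a ∈ nonDesc r S → b ∈ nonDesc r S) := by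
    intro A B h
    induction h with
    | single h => exact step _ _ h
    | @tail C D _ h ih =>
      intro a d ha hd
      obtain ⟨c, hc⟩ := Quotient.exists_rep C
      have h1 := ih a c ha hc
      have h2 := step _ _ h c d hc hd
      exact ⟨fun S hS hh => h1.1 S hS (h2.1 S hS hh),
        fun h4 => h1.2 fun S hS hh => h2.1 S hS (h4 S hS hh)⟩
  have fin : ∀ A, ¬ Relation.TransGen (quotRel r (ndSetoid r ℐ)) A A := by
    intro A h
    obtain ⟨a, ha⟩ := Quotient.exists_rep A
    exact (key A A h a a ha ha).2 fun _ _ hh => hh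
  first
    | exact fin
    | exact ⟨fin⟩
end

section
/- Let V be a type and r : V → V → Prop any relation (the edge relation of a directed graph). Let 𝒩 be a family of subsets of V, each of which is predecessor-closed, i.e., for every N ∈ 𝒩, whenever r u v and v ∈ N, then u ∈ N. Define an equivalence relation on V by u ≈ v iff for every N ∈ 𝒩, (u ∈ N ↔ v ∈ N). Then the quotient graph — whose vertices are the ≈-equivalence classes, with an edge from class A to class B iff A ≠ B and there exist a ∈ A, b ∈ B with r a b — is acyclic: the transitive closure of the quotient edge relation is irreflexive. -/
/-- The equivalence relation "agreeing on membership in every member of the family `𝒩`". -/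
def memSetoid {V : Type*} (𝒩 : Set (Set V)) : Setoid V :=
  ⟨fun u v => ∀ N ∈ 𝒩, (u ∈ N ↔ v ∈ N),
   ⟨fun _ _ _ => Iff.rfl,
    fun h N hN => (h N hN).symm,
    fun h1 h2 N hN => (h1 N hN).trans (h2 N hN)⟩⟩

/-- If every member of the family `𝒩` of subsets of the vertices is predecessor-closed,
then the quotient graph with respect to the partition induced by agreeing on membership
in every member of `𝒩` is acyclic. -/
theorem quotient_graph_of_predClosed_family_acyclic
    {V : Type*} (r : V → V → Prop) (𝒩 : Set (Set V))
    (hclosed : ∀ N ∈ 𝒩, ∀ u v : V, r u v → v ∈ N → u ∈ N) :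
    Irreflexive (Relation.TransGen (quotRel r (memSetoid 𝒩))) := by
  have edge : ∀ A B, quotRel r (memSetoid 𝒩) A B → ∀ a b : V,
      Quotient.mk (memSetoid 𝒩) a = A → Quotient.mk (memSetoid 𝒩) b = B →
      ∀ N ∈ 𝒩, b ∈ N → a ∈ N := by
    rintro A B ⟨_, a', b', ha', hb', hr⟩ a b ha hb N hN hbN
    have h1 : ∀ N ∈ 𝒩, (a ∈ N ↔ a' ∈ N) := Quotient.exact (ha.trans ha'.symm)
    have h2 : ∀ N ∈ 𝒩, (b ∈ N ↔ b' ∈ N) := Quotient.exact (hb.trans hb'.symm)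
    exact (h1 N hN).2 (hclosed N hN a' b' hr ((h2 N hN).1 hbN))
  have key : ∀ A B, Relation.TransGen (quotRel r (memSetoid 𝒩)) A B → A ≠ B ∧ ∀ a b : V,
      Quotient.mk (memSetoid 𝒩) a = A → Quotient.mk (memSetoid 𝒩) b = B →
      ∀ N ∈ 𝒩, b ∈ N → a ∈ N := by
    intro A B h
    induction h with
    | single h => exact ⟨h.1, edge _ _ h⟩
    | @tail B C _ h ih =>
      refine ⟨?_, ?_⟩
      · intro hAC
        obtain ⟨b, hb⟩ := Quotient.exists_rep B
        obtain ⟨c, hc⟩ := Quotient.exists_rep C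
        apply h.1
        rw [← hb, ← hc]
        exact Quotient.sound (s := memSetoid 𝒩) (fun N hN =>
          ⟨ih.2 c b (hc.trans hAC.symm) hb N hN, edge _ _ h b c hb hc N hN⟩)
      · intro a c ha hc N hN hcN
        obtain ⟨b, hb⟩ := Quotient.exists_rep B
        exact ih.2 a b ha hb N hN (edge _ _ h b c hb hc N hN hcN)
  intro A h
  exact (key A A h).1 rfl
end

section
/- Let (Ω, P) be a probability space, M a nonempty standard Borel space, and M' a measurable space. Let W : Ω → M and Y : Ω → M' be measurable, let f : M × M' → M be measurable, and set Z := fun ω => f (W ω, Y ω). If W and Y are independent (IndepFun W Y with respect to P) and Z and Y are independent (IndepFun Z Y with respect to P), then for (Measure.map Y P)-almost every y, the pushforward of the law of W under the slice f(·, y) equals the law of Z: Measure.map (fun m => f (m, y)) (Measure.map W P) = Measure.map Z P. -/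
open MeasureTheory ProbabilityTheory

/-- Let `W : Ω → M` and `Y : Ω → M'` be measurable with `M` a nonempty standard Borel
space, `f : M × M' → M` measurable, and `Z ω = f (W ω, Y ω)`. If `W ⟂ Y` and `Z ⟂ Y`,
then for `(map Y P)`-almost every `y`, the pushforward of the law of `W` under the slice
`f (·, y)` equals the law of `Z`. -/
theorem slice_pushforward_ae_eq_law_of_indep
    {Ω M M' : Type*} [MeasurableSpace Ω]
    [MeasurableSpace M] [StandardBorelSpace M] [Nonempty M]
    [MeasurableSpace M']
    (P : Measure Ω) [IsProbabilityMeasure P]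
    (W : Ω → M) (Y : Ω → M') (f : M × M' → M)
    (hW : Measurable W) (hY : Measurable Y) (hf : Measurable f)
    (hWY : IndepFun W Y P)
    (hZY : IndepFun (fun ω => f (W ω, Y ω)) Y P) :
    ∀ᵐ y ∂(Measure.map Y P),
      Measure.map (fun m => f (m, y)) (Measure.map W P)
        = Measure.map (fun ω => f (W ω, Y ω)) P := by
  have hZ : Measurable (fun ω => f (W ω, Y ω)) := hf.comp (hW.prodMk hY)
  have := Measure.isProbabilityMeasure_map (μ := P) hW.aemeasurable
  have := Measure.isProbabilityMeasure_map (μ := P) hY.aemeasurable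
  have := Measure.isProbabilityMeasure_map (μ := P) hZ.aemeasurable
  let κ : Kernel M' M := (Kernel.const M' (P.map W) ×ₖ Kernel.id).map f
  let η : Kernel M' M := Kernel.const M' (P.map (fun ω => f (W ω, Y ω)))
  have hκ : ∀ y, κ y = (P.map W).map (fun m => f (m, y)) := by
    intro y
    simp only [κ]
    rw [Kernel.map_apply _ hf, Kernel.prod_apply, Kernel.const_apply, Kernel.id_apply,
      Measure.prod_dirac, Measure.map_map hf (by fun_prop)]
    rfl
  have : IsMarkovKernel κ := Kernel.IsMarkovKernel.map _ hf
  have h1 := hWY.symm.map_prod_eq_prod_map_map hY.aemeasurable hW.aemeasurable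
  have h2 := hZY.symm.map_prod_eq_prod_map_map hY.aemeasurable hZ.aemeasurable
  have key : P.map Y ⊗ₘ κ = P.map Y ⊗ₘ η := by
    simp only [η]
    rw [Measure.compProd_const, ← h2]
    have hg : Measurable (fun p : M' × M => (p.1, f (p.2, p.1))) := by fun_prop
    have h3 : P.map (fun ω => (Y ω, f (W ω, Y ω)))
        = ((P.map Y).prod (P.map W)).map (fun p : M' × M => (p.1, f (p.2, p.1))) := by
      rw [← h1, Measure.map_map hg (hY.prodMk hW)]
      rfl
    rw [h3]
    ext s hs
    rw [Measure.compProd_apply hs, Measure.map_apply hg hs, Measure.prod_apply (hg hs)]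
    refine lintegral_congr fun y => ?_
    rw [hκ, Measure.map_apply (by fun_prop) (measurable_prodMk_left hs)]
    rfl
  filter_upwards [Kernel.ae_eq_of_compProd_eq key] with y hy
  rw [← hκ, hy]
  rfl
end

section
/- Let μ be a probability measure on ℝ with full support, i.e., μ(Ioo a b) > 0 for all a < b. If h : ℝ → ℝ is strictly monotone increasing (StrictMono h) and measure-preserving, Measure.map h μ = μ, then h is the identity map: h x = x for all x ∈ ℝ. (In other words, the only orientation-preserving monotone transformation of ℝ in the stabilizer of a fully supported probability distribution is the identity.) -/
open MeasureTheory

/-- The only strictly increasing measure-preserving transformation of a fully supported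
probability measure on `ℝ` is the identity. -/
theorem strictMono_measurePreserving_eq_id
    (μ : Measure ℝ) [IsProbabilityMeasure μ]
    (hfull : ∀ a b : ℝ, a < b → 0 < μ (Set.Ioo a b))
    (h : ℝ → ℝ) (hmono : StrictMono h) (hmap : Measure.map h μ = μ) :
    ∀ x : ℝ, h x = x := by
  have key : StrictMono (fun a : ℝ => μ (Set.Iic a)) := by
    intro a b hab
    have hd : Disjoint (Set.Iic a) (Set.Ioo a b) :=
      Set.disjoint_left.2 fun y hy hy' => absurd hy'.1 (not_lt.2 hy)
    have hs : Set.Iic a ∪ Set.Ioo a b ⊆ Set.Iic b := by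
      rintro y (hy | hy)
      · exact le_trans hy hab.le
      · exact hy.2.le
    calc μ (Set.Iic a) < μ (Set.Iic a) + μ (Set.Ioo a b) :=
          ENNReal.lt_add_right (measure_ne_top _ _) (hfull a b hab).ne'
      _ = μ (Set.Iic a ∪ Set.Ioo a b) := (measure_union hd measurableSet_Ioo).symm
      _ ≤ μ (Set.Iic b) := measure_mono hs
  intro x
  apply key.injective
  have h1 : h ⁻¹' Set.Iic (h x) = Set.Iic x := by
    ext y
    simp [hmono.le_iff_le]
  show μ (Set.Iic (h x)) = μ (Set.Iic x)
  rw [← h1, ← Measure.map_apply hmono.monotone.measurable measurableSet_Iic, hmap]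
end

section
/- Let μ be a probability measure on ℝ with full support, i.e., μ(Ioo a b) > 0 for all a < b. If h₁, h₂ : ℝ → ℝ are strictly decreasing (StrictAnti) surjective maps that are both measure-preserving, Measure.map h₁ μ = μ and Measure.map h₂ μ = μ, then h₁ = h₂. (In other words, the stabilizer of a fully supported probability distribution on ℝ contains at most one orientation-reversing monotone transformation.) -/
open MeasureTheory

/-- A fully supported probability measure on `ℝ` admits at most one strictly decreasing
surjective measure-preserving transformation. -/
theorem strictAnti_measurePreserving_unique
    (μ : Measure ℝ) [IsProbabilityMeasure μ]
    (hfull : ∀ a b : ℝ, a < b → 0 < μ (Set.Ioo a b))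
    (h₁ h₂ : ℝ → ℝ) (hanti₁ : StrictAnti h₁) (hanti₂ : StrictAnti h₂)
    (hsurj₁ : Function.Surjective h₁) (hsurj₂ : Function.Surjective h₂)
    (hmap₁ : Measure.map h₁ μ = μ) (hmap₂ : Measure.map h₂ μ = μ) :
    h₁ = h₂ := by
  have key : ∀ h : ℝ → ℝ, StrictAnti h → Measure.map h μ = μ →
      ∀ x, μ (Set.Iic (h x)) = μ (Set.Ici x) := by
    intro h ha hm x
    have e : h ⁻¹' (Set.Iic (h x)) = Set.Ici x := by
      ext y
      simp [ha.le_iff_ge]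
    rw [← e, ← Measure.map_apply ha.antitone.measurable measurableSet_Iic, hm]
  have inj : ∀ a b : ℝ, a < b → μ (Set.Iic a) ≠ μ (Set.Iic b) := by
    intro a b hab he
    have h1 : μ (Set.Iic a) + μ (Set.Ioo a b) ≤ μ (Set.Iic b) := by
      rw [← measure_union _ measurableSet_Ioo]
      · apply measure_mono
        rintro y (hy | hy)
        · exact le_trans hy hab.le
        · exact hy.2.le
      · rw [Set.disjoint_left]
        intro y hy hy2
        exact absurd hy2.1 (not_lt.mpr hy)
    rw [← he] at h1
    exact absurd h1 (not_le.mpr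
      (ENNReal.lt_add_right (measure_ne_top μ _) (hfull a b hab).ne'))
  funext x
  have e := (key h₁ hanti₁ hmap₁ x).trans (key h₂ hanti₂ hmap₂ x).symm
  rcases lt_trichotomy (h₁ x) (h₂ x) with h | h | h
  · exact absurd e (inj _ _ h)
  · exact h
  · exact absurd e.symm (inj _ _ h)
end

section
/- Let μ be a probability measure on ℝ with full support, i.e., μ(Ioo a b) > 0 for all a < b. Then the stabilizer of μ in the homeomorphism group of ℝ, namely the set {h : Homeomorph ℝ ℝ | Measure.map h μ = μ}, has at most two elements: it consists of the identity and at most one orientation-reversing homeomorphism. In particular, this stabilizer is totally disconnected. -/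
open MeasureTheory

lemma pair_le {α : Type*} (a b : α) : ({a, b} : Set α).encard ≤ 2 := by
  have h := Set.encard_insert_le {b} a
  rw [Set.encard_singleton, one_add_one_eq_two] at h
  exact h

lemma stab_mono (μ : Measure ℝ) [IsProbabilityMeasure μ]
    (hfull : ∀ a b : ℝ, a < b → 0 < μ (Set.Ioo a b)) (h : Homeomorph ℝ ℝ)
    (hm : StrictMono h) (hμ : Measure.map h μ = μ) : h = Homeomorph.refl ℝ := by
  have key : ∀ x, μ (Set.Iic (h x)) = μ (Set.Iic x) := by
    intro x
    conv_lhs => rw [← hμ]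
    rw [Measure.map_apply h.continuous.measurable measurableSet_Iic]
    congr 1
    ext y
    simp [hm.le_iff_le]
  have aux : ∀ a b : ℝ, a < b → μ (Set.Iic a) ≠ μ (Set.Iic b) := by
    intro a b hab he
    have h1 : μ (Set.Iic b \ Set.Iic a) = 0 := by
      rw [measure_sdiff (Set.Iic_subset_Iic.2 hab.le) measurableSet_Iic.nullMeasurableSet
        (measure_ne_top _ _), he, tsub_self]
    have h2 : μ (Set.Ioo a b) = 0 :=
      measure_mono_null (t := Set.Iic b \ Set.Iic a)
        (fun y hy => ⟨hy.2.le, not_le.2 hy.1⟩) h1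
    exact (hfull a b hab).ne' h2
  ext x
  rcases lt_trichotomy (h x) x with hx | hx | hx
  · exact absurd (key x) (aux _ _ hx)
  · exact hx
  · exact absurd (key x).symm (aux _ _ hx)

lemma stab_anti (μ : Measure ℝ) [IsProbabilityMeasure μ]
    (hfull : ∀ a b : ℝ, a < b → 0 < μ (Set.Ioo a b)) (g h : Homeomorph ℝ ℝ)
    (hg : StrictAnti g) (hh : StrictAnti h)
    (hgμ : Measure.map g μ = μ) (hhμ : Measure.map h μ = μ) (x : ℝ) : g (h x) = x := by
  have := stab_mono μ hfull (h.trans g) (hg.comp hh) (by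
    have := Measure.map_map (μ := μ) g.continuous.measurable h.continuous.measurable
    rw [hhμ, hgμ] at this
    exact this.symm)
  exact congrArg (fun k : Homeomorph ℝ ℝ => k x) this

/-- The stabilizer of a fully supported probability measure `μ` on `ℝ` inside the
homeomorphism group of `ℝ` contains the identity, has at most two elements, and every
non-identity member is orientation-reversing (strictly decreasing); in particular it is
totally disconnected (with respect to the topology induced by the compact-open topology
on continuous maps). -/
theorem stabilizer_of_fullSupport_measure_encard_le_two
    (μ : Measure ℝ) [IsProbabilityMeasure μ]
    (hfull : ∀ a b : ℝ, a < b → 0 < μ (Set.Ioo a b)) :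
    Homeomorph.refl ℝ ∈ {h : Homeomorph ℝ ℝ | Measure.map h μ = μ} ∧
    {h : Homeomorph ℝ ℝ | Measure.map h μ = μ}.encard ≤ 2 ∧
    (∀ h ∈ {h : Homeomorph ℝ ℝ | Measure.map h μ = μ},
      h = Homeomorph.refl ℝ ∨ StrictAnti h) ∧
    (letI : TopologicalSpace (Homeomorph ℝ ℝ) :=
      TopologicalSpace.induced (fun h : Homeomorph ℝ ℝ => (h : C(ℝ, ℝ))) inferInstance
     IsTotallyDisconnected {h : Homeomorph ℝ ℝ | Measure.map h μ = μ}) := by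
  have hcl : ∀ h ∈ {h : Homeomorph ℝ ℝ | Measure.map h μ = μ},
      h = Homeomorph.refl ℝ ∨ StrictAnti h := by
    intro h hh
    rcases h.continuous.strictMono_of_inj h.injective with hm | hm
    · exact Or.inl (stab_mono μ hfull h hm hh)
    · exact Or.inr hm
  have hcard : {h : Homeomorph ℝ ℝ | Measure.map h μ = μ}.encard ≤ 2 := by
    by_cases hex : ∃ g : Homeomorph ℝ ℝ, Measure.map g μ = μ ∧ StrictAnti g
    · obtain ⟨g, hgμ, hg⟩ := hex
      refine (Set.encard_le_encard (t := {Homeomorph.refl ℝ, g}) ?_).trans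
        (pair_le _ _)
      intro h hh
      rcases hcl h hh with h1 | h1
      · exact Or.inl h1
      · right
        ext x
        apply g.injective
        rw [stab_anti μ hfull g h hg h1 hgμ hh, stab_anti μ hfull g g hg hg hgμ hgμ]
    · refine (Set.encard_le_encard (t := {Homeomorph.refl ℝ, Homeomorph.refl ℝ}) ?_).trans
        (pair_le _ _)
      intro h hh
      rcases hcl h hh with h1 | h1
      · exact Or.inl h1
      · exact absurd ⟨h, hh, h1⟩ hex
  refine ⟨?_, hcard, hcl, ?_⟩
  · exact Measure.map_id
  · letI : TopologicalSpace (Homeomorph ℝ ℝ) :=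
      TopologicalSpace.induced (fun h : Homeomorph ℝ ℝ => (h : C(ℝ, ℝ))) inferInstance
    have hfin : {h : Homeomorph ℝ ℝ | Measure.map h μ = μ}.Finite :=
      Set.finite_of_encard_le_coe (k := 2) hcard
    have hinj : Function.Injective (fun h : Homeomorph ℝ ℝ => (h : C(ℝ, ℝ))) := by
      intro a b hab
      ext x
      exact congrArg (fun k : C(ℝ, ℝ) => k x) hab
    haveI : T1Space (Homeomorph ℝ ℝ) := t1Space_of_injective_of_continuous hinj
      continuous_induced_dom
    intro t hts ht
    by_contra hns
    rw [Set.not_subsingleton_iff] at hns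
    exact ht.infinite_of_nontrivial hns (hfin.subset hts)
end

section
/- Let μ be a probability measure on ℝ with full support, i.e., μ(Ioo a b) > 0 for all a < b. Let T be a preconnected topological space and f : ℝ × T → ℝ a continuous function such that for every t ∈ T, the slice f(·, t) : ℝ → ℝ is bijective and measure-preserving, Measure.map (fun x => f (x, t)) μ = μ. Then f does not depend on its second argument: f (x, t) = f (x, t') for all x ∈ ℝ and t, t' ∈ T. (Statistical invariance of μ under a connected family of transformations forces functional independence of the family from its parameter, because the stabilizer of μ is totally disconnected.) -/
open MeasureTheory

/-- Let `μ` be a fully supported probability measure on `ℝ`, `T` a preconnected space,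
and `f : ℝ × T → ℝ` continuous with every slice `f (·, t)` bijective and
measure-preserving for `μ`. Then `f` does not depend on its second argument. -/
theorem connected_family_of_measurePreserving_is_constant_in_param
    (μ : Measure ℝ) [IsProbabilityMeasure μ]
    (hfull : ∀ a b : ℝ, a < b → 0 < μ (Set.Ioo a b))
    {T : Type*} [TopologicalSpace T] [PreconnectedSpace T]
    (f : ℝ × T → ℝ) (hf : Continuous f)
    (hbij : ∀ t : T, Function.Bijective (fun x => f (x, t)))
    (hmap : ∀ t : T, Measure.map (fun x => f (x, t)) μ = μ) :
    ∀ (x : ℝ) (t t' : T), f (x, t) = f (x, t') := by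
  have hF : ∀ a b : ℝ, μ (Set.Iio a) = μ (Set.Iio b) → a = b := by
    have key : ∀ a b : ℝ, a < b → μ (Set.Iio a) < μ (Set.Iio b) := by
      intro a b hab
      have hd : Disjoint (Set.Iio a) (Set.Ioo a b) := by
        rw [Set.disjoint_left]
        intro x hx hx'
        exact absurd hx'.1 (not_lt.mpr (le_of_lt hx))
      have h1 : μ (Set.Iio a ∪ Set.Ioo a b) = μ (Set.Iio a) + μ (Set.Ioo a b) :=
        measure_union hd measurableSet_Ioo
      have h2 : μ (Set.Iio a ∪ Set.Ioo a b) ≤ μ (Set.Iio b) := by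
        apply measure_mono
        rintro x (hx | hx)
        · exact lt_trans hx hab
        · exact hx.2
      calc μ (Set.Iio a) < μ (Set.Iio a) + μ (Set.Ioo a b) :=
            ENNReal.lt_add_right (measure_ne_top _ _) (hfull a b hab).ne'
        _ ≤ _ := h1 ▸ h2
    intro a b h
    rcases lt_trichotomy a b with hab | hab | hab
    · exact absurd h (key a b hab).ne
    · exact hab
    · exact absurd h (key b a hab).ne'
  have hc : ∀ t, Continuous (fun x => f (x, t)) := fun t => by fun_prop
  have hpre : ∀ t y, μ (Set.Iio y) = μ ((fun x => f (x, t)) ⁻¹' Set.Iio y) := by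
    intro t y
    rw [← Measure.map_apply (hc t).measurable measurableSet_Iio, hmap t]
  have hor : ∀ t, StrictMono (fun x => f (x, t)) ∨ StrictAnti (fun x => f (x, t)) :=
    fun t => (hc t).strictMono_of_inj (hbij t).1
  have hmono : ∀ t, StrictMono (fun x => f (x, t)) → ∀ x,
      μ (Set.Iio (f (x, t))) = μ (Set.Iio x) := by
    intro t ht x
    rw [hpre t]
    congr 1
    ext y
    exact ht.lt_iff_lt
  have hanti : ∀ t, StrictAnti (fun x => f (x, t)) → ∀ x,
      μ (Set.Iio (f (x, t))) = μ (Set.Ioi x) := by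
    intro t ht x
    rw [hpre t]
    congr 1
    ext y
    exact ht.lt_iff_gt
  have hclopen : IsClopen {t : T | f (0, t) < f (1, t)} := by
    constructor
    · have : {t : T | f (0, t) < f (1, t)} = {t : T | f (0, t) ≤ f (1, t)} := by
        ext t
        simp only [Set.mem_setOf_eq]
        refine ⟨fun h => le_of_lt h, fun h => lt_of_le_of_ne h fun he => ?_⟩
        exact zero_ne_one ((hbij t).1 he)
      rw [this]
      exact isClosed_le (by fun_prop) (by fun_prop)
    · exact isOpen_lt (by fun_prop) (by fun_prop)
  intro x t t'
  apply hF
  have h01 : (0 : ℝ) < 1 := zero_lt_one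
  have hiff : f (0, t) < f (1, t) ↔ f (0, t') < f (1, t') := by
    rcases isClopen_iff.mp hclopen with h | h
    · have h1 : t ∉ {t : T | f (0, t) < f (1, t)} := by rw [h]; simp
      have h2 : t' ∉ {t : T | f (0, t) < f (1, t)} := by rw [h]; simp
      exact iff_of_false h1 h2
    · have h1 : t ∈ {t : T | f (0, t) < f (1, t)} := by rw [h]; simp
      have h2 : t' ∈ {t : T | f (0, t) < f (1, t)} := by rw [h]; simp
      exact iff_of_true h1 h2
  rcases hor t with h | h <;> rcases hor t' with h' | h'
  · rw [hmono t h, hmono t' h']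
  · exact absurd (hiff.mp (h h01)) (h' h01).not_gt
  · exact absurd (hiff.mpr (h' h01)) (h h01).not_gt
  · rw [hanti t h, hanti t' h']
end
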